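/- Σ_{n≥0} (q^{n+1};q)_n q^n / ((a;q)_{n+1} (q^2;q)_n (q/a;q)_n) = 1 + [ a + (1+a) Σ_{n≥1} (-1)^n a^n q^{n(n+1)/2} ] / ((q;q)_∞ (a;q)_∞ (q/a;q)_∞). -/

import Mathlib

open scoped BigOperators

/-- finite q-Pochhammer symbol `(x;q)_n = ∏_{j=0}^{n-1} (1 - x q^j)` -/
noncomputable def qPoch (x q : ℂ) (n : ℕ) : ℂ := ∏ j ∈ Finset.range n, (1 - x * q ^ j)

/-- infinite q-Pochhammer symbol `(x;q)_∞ = ∏_{j≥0} (1 - x q^j)` -/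
noncomputable def qPochInf (x q : ℂ) : ℂ := ∏' j : ℕ, (1 - x * q ^ j)

/-- Gaussian binomial coefficient in base q, zero outside `0 ≤ k ≤ m`. -/
noncomputable def qbinom (q : ℂ) (m k : ℤ) : ℂ :=
  if 0 ≤ k ∧ k ≤ m then
    qPoch q q m.toNat / (qPoch q q k.toNat * qPoch q q (m - k).toNat)
  else 0

open Filter Topology

def tri : ℕ → ℕ
  | 0 => 0
  | k + 1 => tri k + (k + 1)

lemma tri_succ (k : ℕ) : tri (k + 1) = tri k + (k + 1) := rfl

lemma tri_eq (k : ℕ) : tri k = k * (k + 1) / 2 := by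
  have h : 2 * tri k = k * (k + 1) := by
    induction k with
    | zero => rfl
    | succ k ih => rw [tri_succ, mul_add, ih]; ring
  omega

lemma le_tri (k : ℕ) : k ≤ tri k := by
  cases k with
  | zero => exact le_rfl
  | succ k => rw [tri_succ]; omega

lemma qPoch_succ (x q : ℂ) (n : ℕ) : qPoch x q (n + 1) = qPoch x q n * (1 - x * q ^ n) := by
  simp [qPoch, Finset.prod_range_succ]

lemma qPoch_zero (x q : ℂ) : qPoch x q 0 = 1 := by simp [qPoch]

lemma qPoch_succ' (x q : ℂ) (n : ℕ) : qPoch x q (n + 1) = (1 - x) * qPoch (x * q) q n := by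
  simp only [qPoch, Finset.prod_range_succ']
  rw [mul_comm]
  congr 1
  · simp
  · exact Finset.prod_congr rfl fun j _ => by ring

lemma qPoch_ne_zero (x q : ℂ) (h : ∀ j : ℕ, 1 - x * q ^ j ≠ 0) (n : ℕ) : qPoch x q n ≠ 0 :=
  Finset.prod_ne_zero_iff.mpr fun j _ => h j

lemma one_sub_ne {q : ℂ} (hq : ‖q‖ < 1) (n : ℕ) : 1 - q ^ (n + 1) ≠ 0 := by
  intro h
  have h1 : ‖q ^ (n + 1)‖ = 1 := by rw [← sub_eq_zero.mp h]; simp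
  rw [norm_pow] at h1
  have := pow_lt_one₀ (norm_nonneg q) hq (Nat.succ_ne_zero n)
  exact absurd h1 this.ne

lemma summable_xq {q : ℂ} (hq : ‖q‖ < 1) (x : ℂ) : Summable fun j : ℕ => ‖-(x * q ^ j)‖ := by
  simp only [norm_neg, norm_mul, norm_pow]
  exact (summable_geometric_of_lt_one (norm_nonneg q) hq).mul_left _

lemma qPoch_tendsto {q : ℂ} (hq : ‖q‖ < 1) (x : ℂ) :
    Tendsto (qPoch x q) atTop (𝓝 (qPochInf x q)) := by
  have h : Multipliable fun j : ℕ => 1 - x * q ^ j := by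
    simpa only [sub_eq_add_neg] using multipliable_one_add_of_summable (summable_xq hq x)
  exact h.hasProd.tendsto_prod_nat

lemma qPochInf_ne_zero {q : ℂ} (hq : ‖q‖ < 1) (x : ℂ) (h : ∀ j : ℕ, 1 - x * q ^ j ≠ 0) :
    qPochInf x q ≠ 0 := by
  have := tprod_one_add_ne_zero_of_summable (f := fun j : ℕ => -(x * q ^ j))
    (fun j => by simpa only [← sub_eq_add_neg] using h j) (summable_xq hq x)
  simpa only [qPochInf, ← sub_eq_add_neg] using this

lemma qPochInf_succ {q : ℂ} (hq : ‖q‖ < 1) (x : ℂ) :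
    qPochInf x q = (1 - x) * qPochInf (x * q) q := by
  refine tendsto_nhds_unique ((qPoch_tendsto hq x).comp (tendsto_add_atTop_nat 1)) ?_
  refine ((qPoch_tendsto hq (x * q)).const_mul (1 - x)).congr fun n => ?_
  simp [qPoch_succ']

/-- `(q;q)_n` -/
noncomputable def PP (q : ℂ) (n : ℕ) : ℂ := qPoch q q n

lemma PP_zero (q : ℂ) : PP q 0 = 1 := qPoch_zero _ _

lemma PP_succ (q : ℂ) (n : ℕ) : PP q (n + 1) = PP q n * (1 - q ^ (n + 1)) := by
  rw [PP, qPoch_succ, PP, pow_succ']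

lemma PP_ne {q : ℂ} (hq : ‖q‖ < 1) (n : ℕ) : PP q n ≠ 0 := by
  refine qPoch_ne_zero _ _ (fun j => ?_) n
  rw [← pow_succ']; exact one_sub_ne hq j

lemma PPinf_ne {q : ℂ} (hq : ‖q‖ < 1) : qPochInf q q ≠ 0 := by
  refine qPochInf_ne_zero hq _ (fun j => ?_)
  rw [← pow_succ']; exact one_sub_ne hq j

lemma PP_bound {q : ℂ} (hq : ‖q‖ < 1) :
    ∃ C : ℝ, 1 ≤ C ∧ ∀ n, ‖PP q n‖ ≤ C ∧ ‖(PP q n)⁻¹‖ ≤ C := by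
  have h1 : Tendsto (PP q) atTop (𝓝 (qPochInf q q)) := qPoch_tendsto hq q
  have h2 := h1.inv₀ (PPinf_ne hq)
  obtain ⟨C1, hC1⟩ := (Metric.isBounded_range_of_tendsto _ h1).exists_norm_le
  obtain ⟨C2, hC2⟩ := (Metric.isBounded_range_of_tendsto _ h2).exists_norm_le
  refine ⟨max 1 (max C1 C2), le_max_left _ _, fun n => ⟨?_, ?_⟩⟩
  · exact (hC1 _ ⟨n, rfl⟩).trans (by simp)
  · exact (hC2 _ ⟨n, rfl⟩).trans (by simp)

/-- q-binomial `[N+k, k]` -/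
noncomputable def bb (q : ℂ) (N k : ℕ) : ℂ := PP q (N + k) / (PP q N * PP q k)

lemma bb_zero {q : ℂ} (hq : ‖q‖ < 1) (N : ℕ) : bb q N 0 = 1 := by
  have := PP_ne hq N
  simp [bb, PP_zero, this]

lemma bb_rec1 {q : ℂ} (hq : ‖q‖ < 1) (N k : ℕ) :
    bb q N (k + 1) = bb q (N + 1) (k + 1) - q ^ (N + 1) * bb q (N + 1) k := by
  have h1 := PP_ne hq N
  have h2 := PP_ne hq k
  have h3 := one_sub_ne hq N
  have h4 := one_sub_ne hq k
  simp only [bb, show N + 1 + (k + 1) = (N + k + 1) + 1 by ring, show N + 1 + k = N + k + 1 by ring,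
    show N + (k + 1) = N + k + 1 by ring]
  rw [PP_succ q (N + k + 1), PP_succ q N, PP_succ q k]
  field_simp
  ring

lemma bb_rec2 {q : ℂ} (hq : ‖q‖ < 1) (N k : ℕ) :
    q ^ (k + 1) * bb q N (k + 1) = bb q (N + 1) (k + 1) - bb q (N + 1) k := by
  have h1 := PP_ne hq N
  have h2 := PP_ne hq k
  have h3 := one_sub_ne hq N
  have h4 := one_sub_ne hq k
  simp only [bb, show N + 1 + (k + 1) = (N + k + 1) + 1 by ring, show N + 1 + k = N + k + 1 by ring,
    show N + (k + 1) = N + k + 1 by ring]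
  rw [PP_succ q (N + k + 1), PP_succ q N, PP_succ q k]
  field_simp
  ring

lemma bb_bound {q : ℂ} (hq : ‖q‖ < 1) : ∃ B : ℝ, 0 ≤ B ∧ ∀ N k, ‖bb q N k‖ ≤ B := by
  obtain ⟨C, hC, h⟩ := PP_bound hq
  refine ⟨C * (C * C), by positivity, fun N k => ?_⟩
  rw [bb, div_eq_mul_inv, mul_inv, norm_mul, norm_mul]
  gcongr
  · exact (h _).1
  · exact (h _).2
  · exact (h _).2

lemma norm_qpow_le {q : ℂ} (hq : ‖q‖ < 1) (k m : ℕ) : ‖q ^ (tri k + m * k)‖ ≤ ‖q‖ ^ k := by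
  rw [norm_pow]
  exact pow_le_pow_of_le_one (norm_nonneg q) hq.le ((le_tri k).trans (Nat.le_add_right _ _))

/-- term of S -/
noncomputable def st (q : ℂ) (N m k : ℕ) : ℂ := (-1) ^ k * bb q N k * q ^ (tri k + m * k)

noncomputable def SS (q : ℂ) (N m : ℕ) : ℂ := ∑' k, st q N m k

lemma st_norm_le {q : ℂ} (hq : ‖q‖ < 1) {B : ℝ} (hB : ∀ N k, ‖bb q N k‖ ≤ B) (N m k : ℕ) :
    ‖st q N m k‖ ≤ B * ‖q‖ ^ k := by
  have hB0 : 0 ≤ B := (norm_nonneg _).trans (hB 0 0)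
  rw [st, norm_mul, norm_mul]
  simp only [norm_pow (-1 : ℂ), norm_neg, norm_one, one_pow, one_mul]
  exact mul_le_mul (hB _ _) (norm_qpow_le hq k m) (norm_nonneg _) hB0

lemma geo_summable {q : ℂ} (hq : ‖q‖ < 1) (B : ℝ) : Summable fun k : ℕ => B * ‖q‖ ^ k :=
  (summable_geometric_of_lt_one (norm_nonneg q) hq).mul_left _

lemma st_summable {q : ℂ} (hq : ‖q‖ < 1) (N m : ℕ) : Summable (st q N m) := by
  obtain ⟨B, _, hB⟩ := bb_bound hq
  exact Summable.of_norm_bounded (geo_summable hq B) (st_norm_le hq hB N m)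

lemma SS_bound {q : ℂ} (hq : ‖q‖ < 1) : ∃ K : ℝ, 0 ≤ K ∧ ∀ N m, ‖SS q N m‖ ≤ K := by
  obtain ⟨B, hB0, hB⟩ := bb_bound hq
  refine ⟨∑' k : ℕ, B * ‖q‖ ^ k, tsum_nonneg fun k => by positivity, fun N m => ?_⟩
  exact tsum_of_norm_bounded (geo_summable hq B).hasSum (st_norm_le hq hB N m)

lemma st_zero {q : ℂ} (hq : ‖q‖ < 1) (N m : ℕ) : st q N m 0 = 1 := by
  simp [st, bb_zero hq, tri]

lemma SS_R1 {q : ℂ} (hq : ‖q‖ < 1) (N m : ℕ) :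
    SS q N m = SS q (N + 1) m + q ^ (N + m + 2) * SS q (N + 1) (m + 1) := by
  simp only [SS]
  rw [(st_summable hq N m).tsum_eq_zero_add, (st_summable hq (N + 1) m).tsum_eq_zero_add,
    st_zero hq, st_zero hq, ← tsum_mul_left, add_assoc, ← Summable.tsum_add]
  · congr 1
    refine tsum_congr fun k => ?_
    simp only [st, tri_succ]
    rw [bb_rec1 hq]
    ring
  · exact (summable_nat_add_iff 1).mpr (st_summable hq _ _)
  · exact (st_summable hq _ _).mul_left _

lemma SS_R2 {q : ℂ} (hq : ‖q‖ < 1) (N m : ℕ) :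
    SS q N (m + 1) = SS q (N + 1) m + q ^ (m + 1) * SS q (N + 1) (m + 1) := by
  simp only [SS]
  rw [(st_summable hq N (m + 1)).tsum_eq_zero_add, (st_summable hq (N + 1) m).tsum_eq_zero_add,
    st_zero hq, st_zero hq, ← tsum_mul_left, add_assoc, ← Summable.tsum_add]
  · congr 1
    refine tsum_congr fun k => ?_
    have := bb_rec2 hq N k
    simp only [st, tri_succ]
    have e : (-1) ^ (k + 1) * bb q N (k + 1) * q ^ (tri k + (k + 1) + (m + 1) * (k + 1)) =
      (-1) ^ (k + 1) * (q ^ (k + 1) * bb q N (k + 1)) * q ^ (tri k + (k + 1) + m * (k + 1)) := by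
      ring
    rw [e, this]
    ring
  · exact (summable_nat_add_iff 1).mpr (st_summable hq _ _)
  · exact (st_summable hq _ _).mul_left _

lemma bb_N0 {q : ℂ} (hq : ‖q‖ < 1) (k : ℕ) : bb q 0 k = 1 := by
  have := PP_ne hq k
  simp [bb, PP_zero, this]

lemma SS_R0 {q : ℂ} (hq : ‖q‖ < 1) (m : ℕ) :
    SS q 0 m + q ^ (m + 1) * SS q 0 (m + 1) = 1 := by
  simp only [SS]
  rw [(st_summable hq 0 m).tsum_eq_zero_add,
    st_zero hq, ← tsum_mul_left, add_assoc, ← Summable.tsum_add]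
  · convert add_zero (1 : ℂ)
    convert tsum_zero with k
    simp only [st, bb_N0 hq, tri_succ]
    ring
  · exact (summable_nat_add_iff 1).mpr (st_summable hq _ _)
  · exact (st_summable hq _ _).mul_left _

/-- coefficient -/
noncomputable def ff (q : ℂ) (n m : ℕ) : ℂ := (-1) ^ m * q ^ (tri m + n * m) * SS q (2 * n) m

lemma ff_rec {q : ℂ} (hq : ‖q‖ < 1) (n m : ℕ) :
    ff q n (m + 1) = (1 + q ^ (2 * n + 2)) * ff q (n + 1) (m + 1)
      - q ^ (n + 1) * (ff q (n + 1) m + ff q (n + 1) (m + 2)) := by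
  have h0 := SS_R2 hq (2 * n) m
  have h1 := SS_R1 hq (2 * n + 1) m
  have h2 := SS_R1 hq (2 * n + 1) (m + 1)
  simp only [ff, show 2 * (n + 1) = 2 * n + 1 + 1 by ring, tri_succ]
  rw [h0, h1, h2]
  ring

lemma ff_rec0 {q : ℂ} (hq : ‖q‖ < 1) (n : ℕ) :
    ff q n 0 = (1 + q ^ (2 * n + 2)) * ff q (n + 1) 0
      - q ^ (n + 1) * (ff q (n + 1) 1 + ff q (n + 1) 1) := by
  have h0 := SS_R1 hq (2 * n) 0
  have h1 := SS_R1 hq (2 * n + 1) 0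
  have h2 := SS_R2 hq (2 * n + 1) 0
  simp only [ff, show 2 * (n + 1) = 2 * n + 1 + 1 by ring, tri]
  simp only [zero_add] at h0 h1 h2 ⊢
  rw [h0, h1, h2]
  ring

lemma ff_recZ {q : ℂ} (hq : ‖q‖ < 1) (n : ℕ) (m : ℤ) :
    ff q n m.natAbs = (1 + q ^ (2 * n + 2)) * ff q (n + 1) m.natAbs
      - q ^ (n + 1) * (ff q (n + 1) (m - 1).natAbs + ff q (n + 1) (m + 1).natAbs) := by
  rcases lt_trichotomy m 0 with h | h | h
  · obtain ⟨p, rfl⟩ : ∃ p : ℕ, m = -((p : ℤ) + 1) := ⟨(-m - 1).toNat, by omega⟩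
    rw [show (-((p : ℤ) + 1)).natAbs = p + 1 by omega,
      show (-((p : ℤ) + 1) - 1).natAbs = p + 2 by omega,
      show (-((p : ℤ) + 1) + 1).natAbs = p by omega, ff_rec hq]
    ring
  · subst h
    simpa using ff_rec0 hq n
  · obtain ⟨p, rfl⟩ : ∃ p : ℕ, m = (p : ℤ) + 1 := ⟨(m - 1).toNat, by omega⟩
    rw [show ((p : ℤ) + 1).natAbs = p + 1 by omega,
      show ((p : ℤ) + 1 - 1).natAbs = p by omega,
      show ((p : ℤ) + 1 + 1).natAbs = p + 2 by omega, ff_rec hq]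

/-- majorant -/
noncomputable def AA (q a : ℂ) (m : ℤ) : ℝ := ‖a‖ ^ m * ‖q‖ ^ tri m.natAbs

lemma AA_nonneg (q a : ℂ) (m : ℤ) : 0 ≤ AA q a m := by unfold AA; positivity

lemma AA_aux {x t : ℝ} (hx : 0 < x) (ht : 0 < t) (ht1 : t < 1) :
    Summable fun n : ℕ => x ^ n * t ^ tri n := by
  refine summable_of_ratio_test_tendsto_lt_one (l := 0) one_pos
    (Eventually.of_forall fun n => by positivity) ?_
  have h : Tendsto (fun n : ℕ => (x * t) * t ^ n) atTop (𝓝 0) := by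
    simpa using (tendsto_pow_atTop_nhds_zero_of_lt_one ht.le ht1).const_mul (x * t)
  refine h.congr fun n => ?_
  rw [Real.norm_of_nonneg (by positivity), Real.norm_of_nonneg (by positivity), tri_succ]
  have : t ^ tri n ≠ 0 := by positivity
  have : x ^ n ≠ 0 := by positivity
  field_simp
  ring

lemma AA_summable {q a : ℂ} (hq : ‖q‖ < 1) (hq0 : q ≠ 0) (ha : a ≠ 0) : Summable (AA q a) := by
  have ht : 0 < ‖q‖ := norm_pos_iff.mpr hq0
  have hx : 0 < ‖a‖ := norm_pos_iff.mpr ha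
  refine Summable.of_nat_of_neg ?_ ?_
  · refine (AA_aux hx ht hq).congr fun n => ?_
    simp [AA]
  · refine (AA_aux (inv_pos.mpr hx) ht hq).congr fun n => ?_
    simp [AA]

lemma ff_le {q : ℂ} {K : ℝ} (hK : ∀ N m, ‖SS q N m‖ ≤ K) (a : ℂ) (n : ℕ) (m : ℤ) :
    ‖a ^ m * ff q n m.natAbs‖ ≤ K * AA q a m * (‖q‖ ^ n) ^ m.natAbs := by
  have hK0 : 0 ≤ K := (norm_nonneg _).trans (hK 0 0)
  rw [ff, AA]
  simp only [norm_mul, norm_pow, norm_neg, norm_one, one_pow, one_mul, norm_zpow]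
  calc _ ≤ ‖a‖ ^ m * (‖q‖ ^ (tri m.natAbs + n * m.natAbs) * K) := by gcongr; exact hK _ _
    _ = _ := by rw [pow_add, pow_mul]; ring

lemma ff_le' {q : ℂ} (hq : ‖q‖ < 1) {K : ℝ} (hK : ∀ N m, ‖SS q N m‖ ≤ K) (a : ℂ) (n : ℕ) (m : ℤ) :
    ‖a ^ m * ff q n m.natAbs‖ ≤ K * AA q a m := by
  have hK0 : 0 ≤ K := (norm_nonneg _).trans (hK 0 0)
  refine (ff_le hK a n m).trans ?_
  refine mul_le_of_le_one_right (mul_nonneg hK0 (AA_nonneg _ _ _)) ?_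
  exact pow_le_one₀ (by positivity) (pow_le_one₀ (norm_nonneg q) hq.le)

lemma ff_summable {q a : ℂ} (hq : ‖q‖ < 1) (hq0 : q ≠ 0) (ha : a ≠ 0) (n : ℕ) :
    Summable fun m : ℤ => a ^ m * ff q n m.natAbs := by
  obtain ⟨K, _, hK⟩ := SS_bound hq
  exact Summable.of_norm_bounded ((AA_summable hq hq0 ha).mul_left K) (ff_le' hq hK a n)

noncomputable def HH (q a : ℂ) (n : ℕ) : ℂ := ∑' m : ℤ, a ^ m * ff q n m.natAbs

lemma shift_p {a : ℂ} (ha : a ≠ 0) {g : ℤ → ℂ} (hg : Summable fun m : ℤ => a ^ m * g m) :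
    HasSum (fun m : ℤ => a ^ m * g (m - 1)) (a * ∑' m : ℤ, a ^ m * g m) := by
  have h := (Equiv.subRight (1 : ℤ)).hasSum_iff.mpr (hg.hasSum.mul_left a)
  refine h.congr_fun ?_
  intro m
  simp only [Function.comp, Equiv.subRight_apply]
  rw [← mul_assoc, ← zpow_one_add₀ ha]
  congr 2
  ring

lemma shift_m {a : ℂ} (ha : a ≠ 0) {g : ℤ → ℂ} (hg : Summable fun m : ℤ => a ^ m * g m) :
    HasSum (fun m : ℤ => a ^ m * g (m + 1)) (a⁻¹ * ∑' m : ℤ, a ^ m * g m) := by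
  have h := (Equiv.addRight (1 : ℤ)).hasSum_iff.mpr (hg.hasSum.mul_left a⁻¹)
  refine h.congr_fun ?_
  intro m
  simp only [Function.comp, Equiv.coe_addRight]
  rw [zpow_add_one₀ ha]
  field_simp

lemma HH_rec {q a : ℂ} (hq : ‖q‖ < 1) (hq0 : q ≠ 0) (ha : a ≠ 0) (n : ℕ) :
    HH q a n = (1 - a * q ^ (n + 1)) * (1 - q ^ (n + 1) / a) * HH q a (n + 1) := by
  have hs := ff_summable hq hq0 ha (n + 1)
  have h1 := shift_p ha (g := fun m => ff q (n + 1) m.natAbs) hs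
  have h2 := shift_m ha (g := fun m => ff q (n + 1) m.natAbs) hs
  have h3 := (hs.hasSum.mul_left (1 + q ^ (2 * n + 2))).sub ((h1.add h2).mul_left (q ^ (n + 1)))
  have h4 := h3.tsum_eq
  have h5 : HH q a n = _ := Eq.trans (tsum_congr fun m => by rw [ff_recZ hq]; ring) h4
  rw [h5]
  change _ = _ * _ * (∑' m : ℤ, a ^ m * ff q (n + 1) m.natAbs)
  field_simp
  ring

lemma HH_zero {q a : ℂ} (hq : ‖q‖ < 1) (hq0 : q ≠ 0) (ha : a ≠ 0) (n : ℕ) :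
    HH q a 0 = qPoch (a * q) q n * qPoch (q / a) q n * HH q a n := by
  induction n with
  | zero => simp [qPoch_zero]
  | succ n ih =>
    rw [ih, HH_rec hq hq0 ha n, qPoch_succ, qPoch_succ]
    ring

/-- limit of S -/
noncomputable def EE (q : ℂ) (m : ℕ) : ℂ := ∑' k, (-1) ^ k * (PP q k)⁻¹ * q ^ (tri k + m * k)

lemma PP_tendsto {q : ℂ} (hq : ‖q‖ < 1) : Tendsto (PP q) atTop (𝓝 (qPochInf q q)) :=
  qPoch_tendsto hq q

lemma bb_tendsto {q : ℂ} (hq : ‖q‖ < 1) (k : ℕ) :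
    Tendsto (fun N => bb q N k) atTop (𝓝 (PP q k)⁻¹) := by
  have h1 := (PP_tendsto hq).comp (tendsto_add_atTop_nat k)
  have h2 := h1.div ((PP_tendsto hq).mul_const (PP q k)) (mul_ne_zero (PPinf_ne hq) (PP_ne hq k))
  have e : qPochInf q q / (qPochInf q q * PP q k) = (PP q k)⁻¹ := by
    have := PPinf_ne hq
    have := PP_ne hq k
    field_simp
  rw [e] at h2
  exact h2

lemma SS_tendsto {q : ℂ} (hq : ‖q‖ < 1) (m : ℕ) :
    Tendsto (fun N => SS q N m) atTop (𝓝 (EE q m)) := by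
  obtain ⟨B, hB0, hB⟩ := bb_bound hq
  refine tendsto_tsum_of_dominated_convergence (geo_summable hq B) (fun k => ?_)
    (Eventually.of_forall fun N k => st_norm_le hq hB N m k)
  exact ((bb_tendsto hq k).const_mul _).mul_const _

lemma EE_rec {q : ℂ} (hq : ‖q‖ < 1) (m : ℕ) : EE q m = (1 - q ^ (m + 1)) * EE q (m + 1) := by
  have h1 := SS_tendsto hq (m + 1)
  have h2 := ((SS_tendsto hq m).comp (tendsto_add_atTop_nat 1)).add
    (((SS_tendsto hq (m + 1)).comp (tendsto_add_atTop_nat 1)).const_mul (q ^ (m + 1)))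
  have h3 := tendsto_nhds_unique (h1.congr fun N => SS_R2 hq N m) h2
  linear_combination -h3

lemma EE_zero {q : ℂ} (hq : ‖q‖ < 1) (n : ℕ) : EE q 0 = PP q n * EE q n := by
  induction n with
  | zero => simp [PP_zero]
  | succ n ih => rw [ih, EE_rec hq n, PP_succ]; ring

lemma EE_tendsto {q : ℂ} (hq : ‖q‖ < 1) : Tendsto (EE q) atTop (𝓝 1) := by
  obtain ⟨C, hC1, hC⟩ := PP_bound hq
  have h : Tendsto (EE q) atTop (𝓝 (∑' k : ℕ, if k = 0 then (1 : ℂ) else 0)) := by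
    refine tendsto_tsum_of_dominated_convergence (geo_summable hq C) (fun k => ?_)
      (Eventually.of_forall fun m k => ?_)
    · by_cases hk : k = 0
      · subst hk
        simp [PP_zero, tri]
      · rw [if_neg hk]
        have h0 : Tendsto (fun m : ℕ => (q ^ k) ^ m) atTop (𝓝 0) := by
          refine tendsto_pow_atTop_nhds_zero_of_norm_lt_one ?_
          rw [norm_pow]
          exact pow_lt_one₀ (norm_nonneg q) hq hk
        have h1 := h0.const_mul ((-1) ^ k * (PP q k)⁻¹ * q ^ tri k)
        rw [mul_zero] at h1
        refine h1.congr fun m => ?_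
        rw [← pow_mul]; ring
    · rw [norm_mul, norm_mul]
      simp only [norm_pow (-1 : ℂ), norm_neg, norm_one, one_pow, one_mul]
      exact mul_le_mul (hC _).2 (norm_qpow_le hq k m) (norm_nonneg _) (by linarith)
  simpa using h

lemma EE_eq {q : ℂ} (hq : ‖q‖ < 1) : EE q 0 = qPochInf q q := by
  have h := (PP_tendsto hq).mul (EE_tendsto hq)
  rw [mul_one] at h
  exact tendsto_nhds_unique (tendsto_const_nhds.congr fun n => EE_zero hq n) h

lemma HH_tendsto {q a : ℂ} (hq : ‖q‖ < 1) (hq0 : q ≠ 0) (ha : a ≠ 0) :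
    Tendsto (HH q a) atTop (𝓝 (qPochInf q q)) := by
  obtain ⟨K, hK0, hK⟩ := SS_bound hq
  have h : Tendsto (HH q a) atTop (𝓝 (∑' m : ℤ, if m = 0 then qPochInf q q else 0)) := by
    refine tendsto_tsum_of_dominated_convergence ((AA_summable hq hq0 ha).mul_left K) (fun m => ?_)
      (Eventually.of_forall fun n m => ff_le' hq hK a n m)
    by_cases hm : m = 0
    · subst hm
      rw [if_pos rfl, ← EE_eq hq]
      have : Tendsto (fun n : ℕ => 2 * n) atTop atTop :=
        tendsto_id.const_mul_atTop' (by norm_num)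
      refine ((SS_tendsto hq 0).comp this).congr fun n => ?_
      simp [ff, tri]
    · rw [if_neg hm]
      refine squeeze_zero_norm (fun n => ff_le hK a n m) ?_
      have h0 : Tendsto (fun n : ℕ => (‖q‖ ^ m.natAbs) ^ n) atTop (𝓝 0) :=
        tendsto_pow_atTop_nhds_zero_of_lt_one (by positivity)
          (pow_lt_one₀ (norm_nonneg q) hq (by omega))
      have h1 := h0.const_mul (K * AA q a m)
      rw [mul_zero] at h1
      refine h1.congr fun n => ?_
      rw [← pow_mul, ← pow_mul, mul_comm n]
  simpa using h

lemma HH_prod {q a : ℂ} (hq : ‖q‖ < 1) (hq0 : q ≠ 0) (ha : a ≠ 0) :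
    HH q a 0 = qPochInf (a * q) q * qPochInf (q / a) q * qPochInf q q := by
  have h := ((qPoch_tendsto hq (a * q)).mul (qPoch_tendsto hq (q / a))).mul (HH_tendsto hq hq0 ha)
  exact tendsto_nhds_unique (tendsto_const_nhds.congr fun n => HH_zero hq hq0 ha n) h

noncomputable def JJ (q a : ℂ) : ℂ := qPochInf q q * qPochInf a q * qPochInf (q / a) q

lemma JJ_eq {q a : ℂ} (hq : ‖q‖ < 1) (hq0 : q ≠ 0) (ha : a ≠ 0) :
    JJ q a = (1 - a) * HH q a 0 := by
  rw [JJ, qPochInf_succ hq a, HH_prod hq hq0 ha]; ring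

lemma JJ_eq' {q a : ℂ} (hq : ‖q‖ < 1) (hq0 : q ≠ 0) (ha : a ≠ 0) (n : ℕ) :
    JJ q a = qPoch a q (n + 1) * qPoch (q / a) q n * HH q a n := by
  rw [JJ_eq hq hq0 ha, HH_zero hq hq0 ha n, qPoch_succ']; ring

/-- coefficients of the symmetric partial theta function -/
noncomputable def tt (q : ℂ) (m : ℕ) : ℂ := (-1) ^ m * q ^ tri m

lemma tt_summable {q a : ℂ} (hq : ‖q‖ < 1) (hq0 : q ≠ 0) (ha : a ≠ 0) :
    Summable fun m : ℤ => a ^ m * tt q m.natAbs := by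
  refine Summable.of_norm_bounded (AA_summable hq hq0 ha) fun m => le_of_eq ?_
  simp [tt, AA]

lemma T_sub_J {q a : ℂ} (hq : ‖q‖ < 1) (hq0 : q ≠ 0) (ha : a ≠ 0) :
    (∑' m : ℤ, a ^ m * tt q m.natAbs) - JJ q a =
      a + (1 + a) * ∑' n : ℕ, (-1 : ℂ) ^ (n + 1) * a ^ (n + 1) * q ^ tri (n + 1) := by
  have hs := ff_summable hq hq0 ha 0
  have h1 := shift_p ha (g := fun m => ff q 0 m.natAbs) hs
  have ht := tt_summable hq hq0 ha
  have h2 := ht.hasSum.sub (hs.hasSum.sub h1)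
  have hz : ∀ m : ℤ, m ∉ Set.range (fun p : ℕ => (p : ℤ) + 1) →
      a ^ m * tt q m.natAbs - (a ^ m * ff q 0 m.natAbs - a ^ m * ff q 0 (m - 1).natAbs) = 0 := by
    intro m hm
    obtain ⟨p, rfl⟩ : ∃ p : ℕ, m = -(p : ℤ) := by
      refine ⟨(-m).toNat, ?_⟩
      by_contra hne
      exact hm ⟨(m - 1).toNat, by simp only []; omega⟩
    rw [show (-(p : ℤ)).natAbs = p by omega, show (-(p : ℤ) - 1).natAbs = p + 1 by omega]
    simp only [tt, ff, tri_succ]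
    have := SS_R0 hq p
    simp only [mul_zero]
    linear_combination -(a ^ (-(p : ℤ)) * (-1) ^ p * q ^ tri p) * this
  have hinj : Function.Injective (fun p : ℕ => (p : ℤ) + 1) := fun x y h => by
    simp only [] at h; omega
  have h3 := (hinj.hasSum_iff hz).mpr h2
  have hT : Summable fun n : ℕ => a ^ n * tt q n := by
    have := ht.comp_injective (Nat.cast_injective (R := ℤ))
    simpa [Function.comp_def] using this
  have hT1 : Summable fun n : ℕ => a ^ (n + 1) * tt q (n + 1) := (summable_nat_add_iff 1).mpr hT
  have h4 := hT1.hasSum.add (hT.hasSum.mul_left a)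
  have h5 : (fun n : ℕ => a ^ (n + 1) * tt q (n + 1) + a * (a ^ n * tt q n)) = _ :=
    funext fun p => (show _ = ((fun m : ℤ => a ^ m * tt q m.natAbs -
      (a ^ m * ff q 0 m.natAbs - a ^ m * ff q 0 (m - 1).natAbs)) ∘ (fun p : ℕ => (p : ℤ) + 1)) p by
      simp only [Function.comp]
      rw [show ((p : ℤ) + 1).natAbs = p + 1 by omega, show ((p : ℤ) + 1 - 1).natAbs = p by omega,
        show (a : ℂ) ^ ((p : ℤ) + 1) = a ^ (p + 1) by exact_mod_cast zpow_natCast a (p + 1)]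
      simp only [tt, ff, tri_succ]
      have := SS_R0 hq p
      simp only [mul_zero]
      linear_combination -(a ^ (p + 1) * (-1) ^ p * q ^ tri p) * this)
  rw [h5] at h4
  have h6 := h3.unique h4
  have h7 : ∑' n : ℕ, (-1 : ℂ) ^ (n + 1) * a ^ (n + 1) * q ^ tri (n + 1) =
      ∑' n : ℕ, a ^ (n + 1) * tt q (n + 1) := tsum_congr fun n => by rw [tt]; ring
  rw [h7, JJ_eq hq hq0 ha, HH]
  rw [hT.tsum_eq_zero_add] at h6
  simp only [tt, pow_zero, tri, mul_one] at h6 ⊢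
  linear_combination h6

noncomputable def uu (q : ℂ) (n k : ℕ) : ℂ :=
  (-1) ^ k * q ^ (n + tri k) * PP q (2 * n + k) / (PP q n * PP q (n + 1) * PP q k)

lemma uu_partial {q : ℂ} (hq : ‖q‖ < 1) (N i : ℕ) : ∀ k, i + 1 + k = N →
    (1 - q ^ N) * (1 - q ^ (N + 1)) * ∑ j ∈ Finset.range (i + 1), uu q j (N - j) =
      (-1) ^ (k + 1) * q ^ (N + tri k) * PP q (N + i + 1) / (PP q i * PP q (i + 1) * PP q k) := by
  induction i with
  | zero =>
    intro k hk
    obtain rfl : N = k + 1 := by omega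
    have h2 := PP_ne hq k
    have h3 := one_sub_ne hq 0
    have h4 := one_sub_ne hq k
    simp only [zero_add, Finset.sum_range_one, uu, Nat.sub_zero, tri_succ, mul_zero, add_zero,
      PP_succ q (k + 1), PP_succ q k, PP_succ q 0, PP_zero]
    simp only [zero_add] at h3
    field_simp
    ring
  | succ i ih =>
    intro k hk
    obtain rfl : N = i + k + 2 := by omega
    rw [Finset.sum_range_succ, mul_add, ih (k + 1) (by omega),
      show i + k + 2 - (i + 1) = k + 1 by omega, uu,
      show 2 * (i + 1) + (k + 1) = 2 * i + k + 3 by ring,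
      show i + k + 2 + (i + 1) + 1 = 2 * i + k + 3 + 1 by ring,
      show i + k + 2 + i + 1 = 2 * i + k + 3 by ring,
      PP_succ q (2 * i + k + 3), PP_succ q (i + 1), PP_succ q i, PP_succ q k, tri_succ]
    have h1 := PP_ne hq i
    have h2 := PP_ne hq k
    have h3 := one_sub_ne hq i
    have h4 := one_sub_ne hq k
    have h5 := one_sub_ne hq (i + 1)
    field_simp
    ring

lemma uu_sum {q : ℂ} (hq : ‖q‖ < 1) (N : ℕ) :
    ∑ p ∈ Finset.HasAntidiagonal.antidiagonal (N + 1), uu q p.1 p.2 = 0 := by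
  rw [Finset.Nat.sum_antidiagonal_eq_sum_range_succ (uu q), Finset.sum_range_succ]
  have h := uu_partial hq (N + 1) N 0 rfl
  have h0 : (1 - q ^ (N + 1)) * (1 - q ^ (N + 1 + 1)) ≠ 0 :=
    mul_ne_zero (one_sub_ne hq N) (one_sub_ne hq (N + 1))
  refine (mul_eq_zero.mp ?_).resolve_left h0
  rw [mul_add, h, Nat.sub_self, uu, show N + 1 + N + 1 = 2 * (N + 1) + 0 by ring,
    PP_succ q (N + 1), PP_succ q N, PP_zero]
  have h1 := PP_ne hq N
  have h3 := one_sub_ne hq N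
  have h5 := one_sub_ne hq (N + 1)
  field_simp
  ring

noncomputable def cc (q : ℂ) (n : ℕ) : ℂ := PP q (2 * n) * (1 - q) / (PP q n * PP q (n + 1))

lemma cc_bound {q : ℂ} (hq : ‖q‖ < 1) : ∃ B : ℝ, 0 ≤ B ∧ ∀ n, ‖cc q n‖ ≤ B := by
  obtain ⟨C, hC, h⟩ := PP_bound hq
  refine ⟨C * ‖1 - q‖ * (C * C), by positivity, fun n => ?_⟩
  rw [cc, div_eq_mul_inv, mul_inv, norm_mul, norm_mul, norm_mul]
  gcongr
  · exact (h _).1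
  · exact (h _).2
  · exact (h _).2

lemma cc_st {q : ℂ} (hq : ‖q‖ < 1) (m n k : ℕ) :
    cc q n * q ^ n * q ^ (n * m) * st q (2 * n) m k = (1 - q) * (q ^ m) ^ (n + k) * uu q n k := by
  have h1 := PP_ne hq n
  have h2 := PP_ne hq (n + 1)
  have h3 := PP_ne hq k
  have h4 := PP_ne hq (2 * n)
  rw [cc, st, uu, bb, ← pow_mul]
  field_simp
  ring

lemma geo2 {q : ℂ} (hq : ‖q‖ < 1) : Summable fun p : ℕ × ℕ => ‖q‖ ^ p.1 * ‖q‖ ^ p.2 :=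
  (summable_geometric_of_lt_one (norm_nonneg q) hq).mul_of_nonneg
    (summable_geometric_of_lt_one (norm_nonneg q) hq) (fun _ => by positivity)
    (fun _ => by positivity)

lemma qinner_sum {q : ℂ} (hq : ‖q‖ < 1) (m : ℕ) :
    ∑' n : ℕ, cc q n * q ^ n * q ^ (n * m) * SS q (2 * n) m = 1 := by
  obtain ⟨B, hB0, hB⟩ := bb_bound hq
  obtain ⟨C, hC0, hC⟩ := cc_bound hq
  have hs : Summable fun p : ℕ × ℕ =>
      cc q p.1 * q ^ p.1 * q ^ (p.1 * m) * st q (2 * p.1) m p.2 := by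
    refine Summable.of_norm_bounded ((geo2 hq).mul_left (C * B)) fun p => ?_
    rw [norm_mul, norm_mul, norm_mul, norm_pow, norm_pow]
    have e1 : ‖q‖ ^ (p.1 * m) ≤ 1 := pow_le_one₀ (norm_nonneg q) hq.le
    calc _ ≤ C * ‖q‖ ^ p.1 * 1 * (B * ‖q‖ ^ p.2) := by
          gcongr
          · exact hC _
          · exact st_norm_le hq hB _ _ _
      _ = _ := by ring
  have h1 : ∑' n : ℕ, cc q n * q ^ n * q ^ (n * m) * SS q (2 * n) m =
      ∑' p : ℕ × ℕ, cc q p.1 * q ^ p.1 * q ^ (p.1 * m) * st q (2 * p.1) m p.2 := by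
    rw [hs.tsum_prod]
    refine tsum_congr fun n => ?_
    rw [SS, ← tsum_mul_left]
  rw [h1, ← Finset.HasAntidiagonal.sigmaAntidiagonalEquivProd.tsum_eq]
  have hs2 := Finset.HasAntidiagonal.sigmaAntidiagonalEquivProd.summable_iff.mpr hs
  refine (Summable.tsum_sigma' (fun n => (hasSum_fintype _).summable) hs2).trans ?_
  have h2 : ∀ N : ℕ, (∑' p : Finset.HasAntidiagonal.antidiagonal N,
      cc q (p : ℕ × ℕ).1 * q ^ (p : ℕ × ℕ).1 * q ^ ((p : ℕ × ℕ).1 * m)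
        * st q (2 * (p : ℕ × ℕ).1) m (p : ℕ × ℕ).2) = if N = 0 then 1 else 0 := by
    intro N
    rw [tsum_fintype, Finset.sum_coe_sort (Finset.HasAntidiagonal.antidiagonal N) (fun p : ℕ × ℕ =>
      cc q p.1 * q ^ p.1 * q ^ (p.1 * m) * st q (2 * p.1) m p.2)]
    have h3 : ∑ p ∈ Finset.HasAntidiagonal.antidiagonal N,
        cc q p.1 * q ^ p.1 * q ^ (p.1 * m) * st q (2 * p.1) m p.2 =
        (1 - q) * (q ^ m) ^ N * ∑ p ∈ Finset.HasAntidiagonal.antidiagonal N, uu q p.1 p.2 := by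
      rw [Finset.mul_sum]
      refine Finset.sum_congr rfl fun p hp => ?_
      rw [cc_st hq, Finset.HasAntidiagonal.mem_antidiagonal.mp hp]
    rw [h3]
    cases N with
    | zero =>
      have := one_sub_ne hq 0
      simp only [zero_add, pow_one] at this
      simp [uu, PP_zero, tri, PP_succ, this]
    | succ N => rw [uu_sum hq]; simp
  exact (tsum_congr h2).trans (by simp)

lemma outer_sum {q a : ℂ} (hq : ‖q‖ < 1) (hq0 : q ≠ 0) (ha : a ≠ 0) :
    ∑' n : ℕ, cc q n * q ^ n * HH q a n = ∑' m : ℤ, a ^ m * tt q m.natAbs := by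
  obtain ⟨K, hK0, hK⟩ := SS_bound hq
  obtain ⟨C, hC0, hC⟩ := cc_bound hq
  have hs : Summable fun p : ℕ × ℤ => cc q p.1 * q ^ p.1 * (a ^ p.2 * ff q p.1 p.2.natAbs) := by
    have h0 := (geo_summable hq C).mul_of_nonneg ((AA_summable hq hq0 ha).mul_left K)
      (fun _ => by positivity) (fun _ => mul_nonneg hK0 (AA_nonneg _ _ _))
    refine Summable.of_norm_bounded h0 fun p => ?_
    rw [norm_mul, norm_mul, norm_pow]
    gcongr
    · exact hC _
    · exact ff_le' hq hK a _ _
  have h1 : ∑' n : ℕ, cc q n * q ^ n * HH q a n =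
      ∑' (n : ℕ) (m : ℤ), cc q n * q ^ n * (a ^ m * ff q n m.natAbs) :=
    tsum_congr fun n => by rw [HH, ← tsum_mul_left]
  rw [h1, ← Summable.tsum_comm (f := fun (n : ℕ) (m : ℤ) =>
    cc q n * q ^ n * (a ^ m * ff q n m.natAbs)) hs]
  refine tsum_congr fun m => ?_
  rw [← mul_one (a ^ m * tt q m.natAbs), ← qinner_sum hq m.natAbs, ← tsum_mul_left]
  refine tsum_congr fun n => ?_
  rw [ff, tt]
  ring

lemma qPoch_shift (q : ℂ) (n k : ℕ) : qPoch (q ^ (n + 1)) q k * PP q n = PP q (n + k) := by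
  induction k with
  | zero => simp [qPoch_zero]
  | succ k ih =>
    rw [qPoch_succ, ← add_assoc, PP_succ, ← ih]
    ring

lemma cc_eq {q : ℂ} (hq : ‖q‖ < 1) (n : ℕ) :
    qPoch (q ^ (n + 1)) q n / qPoch (q ^ 2) q n = cc q n := by
  have h1 := qPoch_shift q n n
  have h2 : PP q (n + 1) = (1 - q) * qPoch (q ^ 2) q n := by rw [PP, qPoch_succ', pow_two]
  have h3 := PP_ne hq n
  have h4 := PP_ne hq (n + 1)
  have h5 : 1 - q ≠ 0 := by simpa using one_sub_ne hq 0
  have h6 : qPoch (q ^ 2) q n ≠ 0 := fun h => h4 (by rw [h2, h, mul_zero])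
  rw [cc, two_mul, ← h1, h2]
  field_simp

/-- Identity \eqref{nNB}: a Ramanujan-style partial theta identity. -/
theorem stmt_10 (q a : ℂ) (hq : ‖q‖ < 1) (hq0 : q ≠ 0) (ha : a ≠ 0)
    (ha' : ∀ n : ℤ, a ≠ q ^ n) :
    ∑' n : ℕ, qPoch (q ^ (n + 1)) q n * q ^ n /
        (qPoch a q (n + 1) * qPoch (q ^ 2) q n * qPoch (q / a) q n)
      = 1 + (a + (1 + a) *
            ∑' n : ℕ, (-1 : ℂ) ^ (n + 1) * a ^ (n + 1) * q ^ ((n + 1) * (n + 2) / 2))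
          / (qPochInf q q * qPochInf a q * qPochInf (q / a) q) := by
  have hA : ∀ j : ℕ, 1 - a * q ^ j ≠ 0 := fun j h => by
    refine ha' (-(j : ℤ)) ?_
    rw [zpow_neg, zpow_natCast]
    exact eq_inv_of_mul_eq_one_left (sub_eq_zero.mp h).symm
  have hB : ∀ j : ℕ, 1 - q / a * q ^ j ≠ 0 := fun j h => by
    refine ha' ((j + 1 : ℕ) : ℤ) ?_
    rw [zpow_natCast]
    field_simp at h
    rw [pow_succ']
    linear_combination h
  have hJ : JJ q a ≠ 0 :=
    mul_ne_zero (mul_ne_zero (PPinf_ne hq) (qPochInf_ne_zero hq a hA)) (qPochInf_ne_zero hq _ hB)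
  have h1 : ∀ n : ℕ, qPoch (q ^ (n + 1)) q n * q ^ n /
      (qPoch a q (n + 1) * qPoch (q ^ 2) q n * qPoch (q / a) q n) =
      (JJ q a)⁻¹ * (cc q n * q ^ n * HH q a n) := by
    intro n
    have e := JJ_eq' hq hq0 ha n
    have hH : HH q a n ≠ 0 := fun h => hJ (by rw [e, h, mul_zero])
    have n1 := qPoch_ne_zero a q hA (n + 1)
    have n2 := qPoch_ne_zero (q / a) q hB n
    rw [e, ← cc_eq hq n]
    field_simp
  have h2 := T_sub_J hq hq0 ha
  have h3 : ∀ n : ℕ, (n + 1) * (n + 2) / 2 = tri (n + 1) := fun n => by rw [tri_eq]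
  simp only [h3]
  rw [tsum_congr h1, tsum_mul_left, outer_sum hq hq0 ha, ← h2]
  change _ = 1 + _ / JJ q a
  field_simp
  ring
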